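/- Let ψ : ℝ² → ℝ be a Schwartz function and let I ⊂ [0,π] be a measurable set. Then ∫_{I⊥} ‖P_θψ‖₂² dθ = ∬_{x−y ∈ K_I} ψ(x) ψ(y) |x−y|^{−1} dx dy. -/

import Mathlib

open MeasureTheory Measure Set Filter Metric
open scoped ENNReal Real Topology Classical

/-- The cone `K_J = {r e^{iθ} : r ∈ ℝ, θ ∈ J} ⊆ ℂ`. -/
def coneOf (J : Set ℝ) : Set ℂ :=
  {z | ∃ r θ : ℝ, θ ∈ J ∧ z = (r : ℂ) * Complex.exp ((θ : ℂ) * Complex.I)}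

/-- The projection of a function `ψ : ℂ → ℝ` onto the line `L_θ`, in the coordinate `r` of
the point `r e^{iθ}`: `(P_θ ψ)(r) = ∫_{L_θ^⊥} ψ(r e^{iθ} + t·i e^{iθ}) dt`. -/
noncomputable def projFun (ψ : ℂ → ℝ) (θ r : ℝ) : ℝ :=
  ∫ t : ℝ, ψ ((r : ℂ) * Complex.exp ((θ : ℂ) * Complex.I) +
      (t : ℂ) * Complex.exp ((θ : ℂ) * Complex.I) * Complex.I)

/-- The weight `(1 + ‖x‖)⁻³`, integrable in real dimension at most two. -/
noncomputable def cubicWeight {E : Type*} [NormedAddCommGroup E] (x : E) : ℝ :=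
  ((1 + ‖x‖) ^ 3)⁻¹

lemma integrable_cubicWeight {E : Type*} [NormedAddCommGroup E] [NormedSpace ℝ E]
    [FiniteDimensional ℝ E] [MeasurableSpace E] [BorelSpace E] (μ : Measure E)
    [μ.IsAddHaarMeasure] (h : Module.finrank ℝ E < 3) :
    Integrable (fun x : E => cubicWeight x) μ := by
  have := integrable_one_add_norm (E := E) (μ := μ) (r := 3) (by exact_mod_cast h)
  refine this.congr (Eventually.of_forall fun x => ?_)
  have : 0 ≤ 1 + ‖x‖ := by positivity
  simp only [cubicWeight, Real.rpow_neg this]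
  norm_cast

lemma SchwartzMap.exists_abs_mul_shift_le (ψ : SchwartzMap ℂ ℝ) :
    ∃ C : ℝ, ∀ y z : ℂ, |ψ (y + z) * ψ y| ≤ C * (cubicWeight z * cubicWeight y) := by
  obtain ⟨D, hD⟩ : ∃ D : ℝ, ∀ x : ℂ, (1 + ‖x‖) ^ 6 * |ψ x| ≤ D :=
    ⟨_, fun x => by
      simpa using SchwartzMap.one_add_le_sup_seminorm_apply (𝕜 := ℝ) (m := (6, 0)) (k := 6)
        (n := 0) le_rfl le_rfl ψ x⟩
  refine ⟨D * D, fun y z => ?_⟩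
  have h1 : 1 + ‖z‖ ≤ (1 + ‖y + z‖) * (1 + ‖y‖) := by
    have : ‖z‖ ≤ ‖y + z‖ + ‖y‖ := by simpa using norm_sub_le (y + z) y
    nlinarith [mul_nonneg (norm_nonneg (y + z)) (norm_nonneg y)]
  have h2 : (1 + ‖z‖) ^ 3 * (1 + ‖y‖) ^ 3 ≤ (1 + ‖y + z‖) ^ 6 * (1 + ‖y‖) ^ 6 := calc
    _ ≤ ((1 + ‖y + z‖) * (1 + ‖y‖)) ^ 3 * (1 + ‖y‖) ^ 3 := by gcongr
    _ = (1 + ‖y + z‖) ^ 3 * (1 + ‖y‖) ^ 6 := by ring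
    _ ≤ _ := by
      gcongr
      · linarith [norm_nonneg (y + z)]
      · norm_num
  have h3 : ((1 + ‖z‖) ^ 3 * (1 + ‖y‖) ^ 3) * |ψ (y + z) * ψ y| ≤ D * D := calc
    _ ≤ ((1 + ‖y + z‖) ^ 6 * (1 + ‖y‖) ^ 6) * |ψ (y + z) * ψ y| := by gcongr
    _ = ((1 + ‖y + z‖) ^ 6 * |ψ (y + z)|) * ((1 + ‖y‖) ^ 6 * |ψ y|) := by rw [abs_mul]; ring
    _ ≤ D * D := mul_le_mul (hD _) (hD _) (by positivity) (le_trans (by positivity) (hD 0))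
  unfold cubicWeight
  rw [← mul_inv, ← div_eq_mul_inv, le_div_iff₀ (by positivity), mul_comm]
  exact h3

/-- The autocorrelation of `ψ`. -/
noncomputable def autocorr (ψ : ℂ → ℝ) (z : ℂ) : ℝ := ∫ y, ψ (y + z) * ψ y

lemma autocorr_neg (ψ : ℂ → ℝ) (z : ℂ) : autocorr ψ (-z) = autocorr ψ z := by
  unfold autocorr
  rw [← integral_add_right_eq_self _ z]
  simp [mul_comm]

lemma SchwartzMap.measurable_autocorr (ψ : SchwartzMap ℂ ℝ) : Measurable (autocorr ψ) := by
  have : Continuous fun p : ℂ × ℂ => ψ (p.2 + p.1) * ψ p.2 := by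
    have := ψ.continuous
    fun_prop
  exact (this.stronglyMeasurable.integral_prod_right (ν := volume)).measurable

lemma SchwartzMap.exists_abs_autocorr_le (ψ : SchwartzMap ℂ ℝ) :
    ∃ C : ℝ, ∀ z, |autocorr ψ z| ≤ C * cubicWeight z := by
  obtain ⟨C, hC⟩ := ψ.exists_abs_mul_shift_le
  refine ⟨C * ∫ y : ℂ, cubicWeight y, fun z => ?_⟩
  have hw : Integrable (fun y : ℂ => cubicWeight y) := integrable_cubicWeight _ (by simp)
  calc |autocorr ψ z| ≤ ∫ y : ℂ, C * cubicWeight z * cubicWeight y := by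
        refine norm_integral_le_of_norm_le (f := fun y => ψ (y + z) * ψ y)
          (hw.const_mul _) (Eventually.of_forall fun y => ?_)
        simpa [mul_assoc] using hC y z
    _ = _ := by rw [integral_const_mul]; ring

lemma measurePreserving_rotated_coordinates (θ : ℝ) :
    MeasurePreserving (fun p : ℝ × ℝ =>
      ((p.1 : ℂ) + p.2 * Complex.I) * Complex.exp (θ * Complex.I)) := by
  have h1 := Complex.volume_preserving_equiv_real_prod.symm
  have h2 := (rotation (Circle.exp θ)).measurePreserving
  convert h2.comp h1 using 2 with p
  apply Complex.ext <;> simp [Complex.measurableEquivRealProd, mul_comm]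

lemma projFun_add_pi_div_two (ψ : ℂ → ℝ) (θ r : ℝ) :
    projFun ψ (θ + π / 2) r
      = ∫ t : ℝ, ψ (((t : ℂ) + r * Complex.I) * Complex.exp (θ * Complex.I)) := by
  have h : Complex.exp (((θ + π / 2 : ℝ) : ℂ) * Complex.I)
      = Complex.exp (θ * Complex.I) * Complex.I := by
    push_cast
    rw [add_mul, Complex.exp_add, Complex.exp_pi_div_two_mul_I]
  unfold projFun
  rw [h, ← integral_neg_eq_self]
  congr 1 with t
  congr 1
  push_cast
  linear_combination (-t * Complex.exp (θ * Complex.I)) * Complex.I_mul_I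

lemma SchwartzMap.integral_projFun_sq (ψ : SchwartzMap ℂ ℝ) (θ : ℝ) :
    ∫ r : ℝ, projFun ψ (θ + π / 2) r ^ 2
      = ∫ ρ : ℝ, autocorr ψ (ρ * Complex.exp (θ * Complex.I)) := by
  obtain ⟨C, hC⟩ := ψ.exists_abs_mul_shift_le
  have hψ := ψ.continuous
  have hnorm (ρ : ℝ) : ‖(ρ : ℂ) * Complex.exp (θ * Complex.I)‖ = ‖ρ‖ := by
    rw [norm_mul, Complex.norm_exp_ofReal_mul_I]; simp
  have hint : Integrable (fun p : ℂ × ℝ =>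
      ψ (p.1 + p.2 * Complex.exp (θ * Complex.I)) * ψ p.1) (volume.prod volume) := by
    refine Integrable.mono' (((integrable_cubicWeight (E := ℂ) volume (by simp)).mul_prod
      (integrable_cubicWeight (E := ℝ) volume (by simp))).const_mul C) ?_ ?_
    · exact Continuous.aestronglyMeasurable (by fun_prop)
    · refine Eventually.of_forall fun p => ?_
      have := hC p.1 (p.2 * Complex.exp (θ * Complex.I))
      rw [mul_comm (cubicWeight _)] at this
      simpa only [cubicWeight, hnorm, Real.norm_eq_abs] using this
  have hK := hint.integral_prod_left
  have hm := (measurePreserving_rotated_coordinates θ).comp measurePreserving_swap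
  have hK' := (hm.integrable_comp hK.aestronglyMeasurable).2 hK
  calc ∫ r : ℝ, projFun ψ (θ + π / 2) r ^ 2
      = ∫ r : ℝ, ∫ s : ℝ, ∫ ρ : ℝ,
          ψ (((s : ℂ) + r * Complex.I) * Complex.exp (θ * Complex.I)
              + ρ * Complex.exp (θ * Complex.I))
            * ψ (((s : ℂ) + r * Complex.I) * Complex.exp (θ * Complex.I)) := by
        congr 1 with r
        rw [projFun_add_pi_div_two, sq, ← integral_const_mul]
        congr 1 with s
        rw [integral_mul_const]
        congr 1
        rw [← integral_add_right_eq_self _ s]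
        congr 1 with ρ
        congr 1
        push_cast
        ring
    _ = ∫ p : ℝ × ℝ, ∫ ρ : ℝ,
          ψ (((p.2 : ℂ) + p.1 * Complex.I) * Complex.exp (θ * Complex.I)
              + ρ * Complex.exp (θ * Complex.I))
            * ψ (((p.2 : ℂ) + p.1 * Complex.I) * Complex.exp (θ * Complex.I)) :=
        (integral_prod _ hK').symm
    _ = ∫ y : ℂ, ∫ ρ : ℝ, ψ (y + ρ * Complex.exp (θ * Complex.I)) * ψ y := by
        rw [← hm.map_eq]
        exact (integral_map hm.aemeasurable
          (by rw [hm.map_eq]; exact hK.aestronglyMeasurable)).symm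
    _ = _ := integral_integral_swap hint

lemma sin_sub_eq_zero_of_mul_exp_eq {r s θ φ : ℝ} (hr : r ≠ 0)
    (h : (r : ℂ) * Complex.exp (θ * Complex.I) = s * Complex.exp (φ * Complex.I)) :
    Real.sin (θ - φ) = 0 := by
  have h1 : (r : ℂ) * Complex.exp ((θ - φ : ℝ) * Complex.I) = s := by
    push_cast
    rw [sub_mul, Complex.exp_sub, mul_div_assoc', h, mul_div_assoc, div_self (Complex.exp_ne_zero _),
      mul_one]
  have h2 := congrArg Complex.im h1
  rw [Complex.im_ofReal_mul, Complex.exp_ofReal_mul_I_im,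
    Complex.ofReal_im] at h2
  exact (mul_eq_zero.1 h2).resolve_left hr

lemma neg_mem_coneOf_iff {J : Set ℝ} {z : ℂ} : -z ∈ coneOf J ↔ z ∈ coneOf J := by
  have key : ∀ w : ℂ, w ∈ coneOf J → -w ∈ coneOf J := by
    rintro w ⟨r, θ, hθ, rfl⟩
    exact ⟨-r, θ, hθ, by push_cast; ring⟩
  exact ⟨fun h => by simpa using key _ h, key z⟩

lemma mul_exp_mem_coneOf_iff {I : Set ℝ} (hI : I ⊆ Icc 0 π) {r θ : ℝ} (hr : r ≠ 0)
    (hθ : θ ∈ Ioo 0 π) : (r : ℂ) * Complex.exp (θ * Complex.I) ∈ coneOf I ↔ θ ∈ I := by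
  refine ⟨?_, fun h => ⟨r, θ, h, rfl⟩⟩
  rintro ⟨s, φ, hφ, h⟩
  have h0 := sin_sub_eq_zero_of_mul_exp_eq hr h
  have hb := hI hφ
  rw [Real.sin_eq_zero_iff_of_lt_of_lt (by linarith [hθ.1, hb.2]) (by linarith [hθ.2, hb.1]),
    sub_eq_zero] at h0
  exact h0 ▸ hφ

lemma mem_coneOf_iff_arg {I : Set ℝ} (hI : I ⊆ Icc 0 π) {z : ℂ} (hz : z ≠ 0) :
    z ∈ coneOf I ↔ z.arg ∈ I ∨ z.arg + π ∈ I ∨ z.arg - π ∈ I := by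
  have hz' := Complex.norm_mul_exp_arg_mul_I z
  constructor
  · rintro ⟨s, φ, hφ, h⟩
    obtain ⟨n, hn⟩ := Real.sin_eq_zero_iff.1
      (sin_sub_eq_zero_of_mul_exp_eq (norm_ne_zero_iff.2 hz) (hz'.trans h))
    have hb := hI hφ
    have ha := Complex.arg_mem_Ioc z
    have h1 : n < 2 := by
      by_contra! hc
      have : (2 : ℝ) ≤ n := by exact_mod_cast hc
      nlinarith [Real.pi_pos, ha.2, hb.1]
    have h2 : -2 < n := by
      by_contra! hc
      have : (n : ℝ) ≤ -2 := by exact_mod_cast hc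
      nlinarith [Real.pi_pos, ha.1, hb.2]
    interval_cases n
    · exact .inr (.inl (by convert hφ using 1; push_cast at hn; linarith))
    · exact .inl (by convert hφ using 1; push_cast at hn; linarith)
    · exact .inr (.inr (by convert hφ using 1; push_cast at hn; linarith))
  · rintro (h | h | h)
    · exact ⟨‖z‖, _, h, hz'.symm⟩
    · refine ⟨-‖z‖, _, h, ?_⟩
      push_cast
      rw [add_mul, Complex.exp_add, Complex.exp_pi_mul_I]
      linear_combination -hz'
    · refine ⟨-‖z‖, _, h, ?_⟩
      push_cast
      rw [sub_mul, Complex.exp_sub, Complex.exp_pi_mul_I]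
      linear_combination -hz'

lemma measurableSet_coneOf {I : Set ℝ} (hI : MeasurableSet I) (hIsub : I ⊆ Icc 0 π) :
    MeasurableSet (coneOf I) := by
  have hS : MeasurableSet {z : ℂ | z.arg ∈ I ∨ z.arg + π ∈ I ∨ z.arg - π ∈ I} :=
    (Complex.measurable_arg hI).union
      (((Complex.measurable_arg.add_const π) hI).union ((Complex.measurable_arg.sub_const π) hI))
  have : coneOf I = ({z : ℂ | z.arg ∈ I ∨ z.arg + π ∈ I ∨ z.arg - π ∈ I} \ {0})
      ∪ (coneOf I ∩ {0}) := by
    ext z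
    by_cases hz : z = 0
    · simp [hz]
    · simp [hz, mem_coneOf_iff_arg hIsub hz]
  rw [this]
  exact (hS.diff (measurableSet_singleton 0)).union
    ((finite_singleton 0).inter_of_right _).measurableSet

lemma Complex.polarCoord_symm_eq_mul_exp (p : ℝ × ℝ) :
    Complex.polarCoord.symm p = (p.1 : ℂ) * Complex.exp (p.2 * Complex.I) := by
  rw [Complex.polarCoord_symm_apply, Complex.exp_mul_I]
  push_cast
  rfl

lemma integrableOn_cubicWeight_fst :
    IntegrableOn (fun p : ℝ × ℝ => cubicWeight p.1) (Ioi 0 ×ˢ Ioo (-π) π) := by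
  have h1 : IntegrableOn (fun r : ℝ => cubicWeight r) (Ioi 0) :=
    (integrable_cubicWeight volume (by simp)).integrableOn
  have h2 : IntegrableOn (fun _ : ℝ => (1 : ℝ)) (Ioo (-π) π) := by simp
  have := h1.mul_prod h2
  rw [prod_restrict, ← volume_eq_prod] at this
  simpa [IntegrableOn] using this

lemma integrable_cubicWeight_mul_norm_inv :
    Integrable (fun z : ℂ => cubicWeight z * ‖z‖⁻¹) := by
  refine ⟨(by unfold cubicWeight; fun_prop), ?_⟩
  rw [hasFiniteIntegral_iff_enorm, ← Complex.lintegral_comp_polarCoord_symm]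
  refine lt_of_eq_of_lt ?_ integrableOn_cubicWeight_fst.2
  refine setLIntegral_congr_fun (measurableSet_Ioi.prod measurableSet_Ioo) fun p hp => ?_
  have hp' : 0 < p.1 := hp.1
  simp only [smul_eq_mul, Real.enorm_eq_ofReal_abs]
  rw [← ENNReal.ofReal_mul hp'.le]
  congr 1
  rw [abs_mul, abs_inv, abs_norm, Complex.norm_polarCoord_symm, abs_of_pos hp', mul_left_comm,
    mul_inv_cancel₀ hp'.ne', mul_one]
  simp [cubicWeight]

lemma integral_integral_line_eq_setIntegral_coneOf {I : Set ℝ} (hI : MeasurableSet I)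
    (hIsub : I ⊆ Icc 0 π) {G : ℂ → ℝ} (hG : Measurable G) {C : ℝ}
    (hGC : ∀ z, |G z| ≤ C * cubicWeight z) (hGneg : ∀ z, G (-z) = G z) :
    ∫ θ in I, ∫ ρ : ℝ, G (ρ * Complex.exp (θ * Complex.I))
      = ∫ z in coneOf I, G z * ‖z‖⁻¹ := by
  have hK := measurableSet_coneOf hI hIsub
  set F : ℂ → ℝ := (coneOf I).indicator G with hF
  have hFm : Measurable F := hG.indicator hK
  have hFneg (z : ℂ) : F (-z) = F z := by
    simp only [hF, indicator, neg_mem_coneOf_iff, hGneg]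
  have hFC (z : ℂ) : |F z| ≤ C * cubicWeight z := by
    by_cases h : z ∈ coneOf I
    · simpa [hF, h] using hGC z
    · simpa [hF, h] using (abs_nonneg _).trans (hGC z)
  set g : ℝ → ℝ := fun θ => ∫ r in Ioi (0 : ℝ), F (r * Complex.exp (θ * Complex.I)) with hg
  have hint : IntegrableOn (fun p : ℝ × ℝ => F (p.1 * Complex.exp (p.2 * Complex.I)))
      (Ioi 0 ×ˢ Ioo (-π) π) := by
    refine Integrable.mono' (integrableOn_cubicWeight_fst.const_mul C)
      (hFm.comp (by fun_prop)).aestronglyMeasurable (Eventually.of_forall fun p => ?_)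
    simpa [cubicWeight, Complex.norm_exp_ofReal_mul_I] using
      hFC (p.1 * Complex.exp (p.2 * Complex.I))
  have hint' : Integrable (fun p : ℝ × ℝ => F (p.1 * Complex.exp (p.2 * Complex.I)))
      ((volume.restrict (Ioi 0)).prod (volume.restrict (Ioo (-π) π))) := by
    rw [prod_restrict]
    exact hint
  have hgint : IntegrableOn g (Ioo (-π) π) := hint'.integral_prod_right
  have hper : Function.Periodic g π := fun θ => by
    refine integral_congr_ae (Eventually.of_forall fun r => ?_)
    dsimp only
    rw [← hFneg]
    congr 1
    push_cast
    rw [add_mul, Complex.exp_add, Complex.exp_pi_mul_I]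
    ring
  have hgI {θ : ℝ} (hθ : θ ∈ Ioo 0 π) :
      2 * g θ = I.indicator (fun θ => ∫ ρ : ℝ, G (ρ * Complex.exp (θ * Complex.I))) θ := by
    by_cases h : θ ∈ I
    · have habs : ∀ r : ℝ, G (r * Complex.exp (θ * Complex.I))
          = G ((|r| : ℝ) * Complex.exp (θ * Complex.I)) := fun r => by
        rcases abs_choice r with hr | hr <;> rw [hr]
        rw [← hGneg]
        simp
      rw [indicator_of_mem h, integral_congr_ae (Eventually.of_forall habs),
        integral_comp_abs (f := fun r : ℝ => G (r * Complex.exp (θ * Complex.I)))]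
      congr 1
      refine setIntegral_congr_fun measurableSet_Ioi fun r hr => ?_
      exact indicator_of_mem ((mul_exp_mem_coneOf_iff hIsub (ne_of_gt hr) hθ).2 h) _
    · rw [indicator_of_notMem h, mul_eq_zero]
      refine .inr (setIntegral_eq_zero_of_forall_eq_zero fun r hr => ?_)
      exact indicator_of_notMem (mt (mul_exp_mem_coneOf_iff hIsub (ne_of_gt hr) hθ).1 h) _
  have hpi := Real.pi_pos
  symm
  calc ∫ z in coneOf I, G z * ‖z‖⁻¹ = ∫ z, F z * ‖z‖⁻¹ := by
        rw [← integral_indicator hK]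
        congr 1 with z
        rw [hF, indicator_mul_left]
    _ = ∫ p in Ioi (0 : ℝ) ×ˢ Ioo (-π) π, F (p.1 * Complex.exp (p.2 * Complex.I)) := by
        rw [← Complex.integral_comp_polarCoord_symm]
        refine setIntegral_congr_fun (measurableSet_Ioi.prod measurableSet_Ioo) fun p hp => ?_
        have hp' : 0 < p.1 := hp.1
        rw [Complex.norm_polarCoord_symm, abs_of_pos hp', Complex.polarCoord_symm_eq_mul_exp,
          smul_eq_mul, mul_left_comm, mul_inv_cancel₀ hp'.ne', mul_one]
    _ = ∫ θ in Ioo (-π) π, g θ := by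
        rw [volume_eq_prod, ← prod_restrict]
        exact integral_prod_symm _ hint'
    _ = ∫ θ in (-π)..π, g θ := by
        rw [intervalIntegral.integral_of_le (by linarith), integral_Ioc_eq_integral_Ioo]
    _ = (∫ θ in (-π)..0, g θ) + ∫ θ in 0..π, g θ := by
        have hi : IntegrableOn g (Ioc (-π) π) := by
          rwa [integrableOn_Ioc_iff_integrableOn_Ioo]
        refine (intervalIntegral.integral_add_adjacent_intervals ?_ ?_).symm
        · rw [intervalIntegrable_iff_integrableOn_Ioc_of_le (by linarith)]
          exact hi.mono_set (Ioc_subset_Ioc_right hpi.le)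
        · rw [intervalIntegrable_iff_integrableOn_Ioc_of_le hpi.le]
          exact hi.mono_set (Ioc_subset_Ioc_left (by linarith))
    _ = ∫ θ in 0..π, 2 * g θ := by
        have := hper.intervalIntegral_add_eq (-π) 0
        rw [neg_add_cancel, zero_add] at this
        rw [this, intervalIntegral.integral_const_mul, two_mul]
    _ = ∫ θ in Icc 0 π, I.indicator
          (fun θ => ∫ ρ : ℝ, G (ρ * Complex.exp (θ * Complex.I))) θ := by
        rw [intervalIntegral.integral_of_le hpi.le, integral_Ioc_eq_integral_Ioo,
          integral_Icc_eq_integral_Ioo]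
        exact setIntegral_congr_fun measurableSet_Ioo fun θ hθ => hgI hθ
    _ = _ := by rw [setIntegral_indicator hI, inter_eq_right.2 hIsub]

lemma SchwartzMap.setIntegral_sub_mem_eq_autocorr (ψ : SchwartzMap ℂ ℝ) (K : Set ℂ) :
    ∫ p in {p : ℂ × ℂ | p.1 - p.2 ∈ K}, ψ p.1 * ψ p.2 * ‖p.1 - p.2‖⁻¹
      = ∫ z in K, autocorr ψ z * ‖z‖⁻¹ := by
  obtain ⟨C, hC⟩ := ψ.exists_abs_mul_shift_le
  have hψ := ψ.continuous
  have hint : Integrable (fun p : ℂ × ℂ => ψ (p.2 + p.1) * ψ p.2 * ‖p.1‖⁻¹)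
      (volume.prod volume) := by
    refine Integrable.mono' ((integrable_cubicWeight_mul_norm_inv.mul_prod
      (integrable_cubicWeight (E := ℂ) volume (by simp))).const_mul C) ?_ ?_
    · exact ((Continuous.measurable (by fun_prop)).mul
        (by fun_prop)).aestronglyMeasurable
    · refine Eventually.of_forall fun p => ?_
      rw [norm_mul, Real.norm_eq_abs, norm_inv, norm_norm]
      calc _ ≤ C * (cubicWeight p.1 * cubicWeight p.2) * ‖p.1‖⁻¹ := by
            gcongr
            exact hC _ _
        _ = _ := by ring
  have hm : MeasurePreserving (fun p : ℂ × ℂ => (p.1 + p.2, p.2)) :=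
    measurePreserving_add_prod (volume : Measure ℂ) (volume : Measure ℂ)
  have he : MeasurableEmbedding (fun p : ℂ × ℂ => (p.1 + p.2, p.2)) := by
    refine (Measurable.measurableEmbedding (by fun_prop) ?_)
    rintro ⟨a, b⟩ ⟨c, d⟩ h
    simp only [Prod.mk.injEq] at h
    obtain ⟨h, rfl⟩ := h
    simpa using h
  rw [← hm.setIntegral_preimage_emb he]
  have : (fun p : ℂ × ℂ => (p.1 + p.2, p.2)) ⁻¹' {p : ℂ × ℂ | p.1 - p.2 ∈ K} = K ×ˢ univ := by
    ext p
    simp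
  rw [this, volume_eq_prod]
  simp only [add_sub_cancel_right]
  simp_rw [add_comm (Prod.fst _)]
  rw [setIntegral_prod _ hint.integrableOn]
  simp only [Measure.restrict_univ, integral_mul_const, autocorr]

/-- For a Schwartz function `ψ : ℝ² → ℝ` and a measurable `I ⊆ [0,π]`,
`∫_{I⊥} ‖P_θ ψ‖₂² dθ = ∬_{x-y ∈ K_I} ψ(x) ψ(y) |x-y|⁻¹ dx dy`. -/
theorem statement7 (ψ : SchwartzMap ℂ ℝ) (I : Set ℝ) (hI : MeasurableSet I)
    (hIsub : I ⊆ Set.Icc 0 π) :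
    (∫ θ in (fun θ => θ + π / 2) '' I, ∫ r : ℝ, (projFun (⇑ψ) θ r) ^ 2)
      = ∫ p in {p : ℂ × ℂ | p.1 - p.2 ∈ coneOf I}, ψ p.1 * ψ p.2 * ‖p.1 - p.2‖⁻¹ := by
  obtain ⟨C, hC⟩ := ψ.exists_abs_autocorr_le
  rw [ψ.setIntegral_sub_mem_eq_autocorr,
    ← integral_integral_line_eq_setIntegral_coneOf hI hIsub ψ.measurable_autocorr hC
      (autocorr_neg ψ),
    (measurePreserving_add_right volume (π / 2)).setIntegral_image_emb
      (measurableEmbedding_addRight _)]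
  simp only [ψ.integral_projFun_sq]
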